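/- Let n ≥ 1 and p ≥ 1. Then, as subsets of P₂(2n), ã_{1,p}(n) = ÑC₂^{T,p}(2n). -/

import Mathlib

open Equiv MeasureTheory ProbabilityTheory

noncomputable section

namespace RibbonNC

/-- The number of cycles `#(σ)` of a permutation, counted on the finite set `S`:
the number of orbits of `σ` meeting `S` (fixed points count as orbits). -/
def cyclesOn {α : Type*} (σ : Equiv.Perm α) (S : Finset α) : ℕ :=
  ((fun a => {b | σ.SameCycle a b}) '' (S : Set α)).ncard

/-- `σ` is a permutation of `S`: it fixes everything outside `S`. -/
def IsPermOn {α : Type*} (σ : Equiv.Perm α) (S : Finset α) : Prop :=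
  ∀ a ∉ S, σ a = a

/-- `σ` is a pairing of `S`: a fixed-point-free involution of `S`, fixing everything
outside `S`. -/
def IsPairingOn {α : Type*} (σ : Equiv.Perm α) (S : Finset α) : Prop :=
  σ * σ = 1 ∧ (∀ a ∈ S, σ a ≠ a) ∧ IsPermOn σ S

/-- `π` is non-crossing with respect to `γ` on `S`: the subgroup generated by `π` and `γ`
acts transitively on `S`, and `#(π) + #(π⁻¹γ) + #(γ) = |S| + 2`. -/
def IsNoncrossingOn {α : Type*} (π γ : Equiv.Perm α) (S : Finset α) : Prop :=
  (∀ a ∈ S, ∀ b ∈ S, ∃ σ ∈ Subgroup.closure ({π, γ} : Set (Equiv.Perm α)), σ a = b) ∧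
  cyclesOn π S + cyclesOn (π⁻¹ * γ) S + cyclesOn γ S = S.card + 2

/-- `[n] = {1, …, n}`, as a finset of integers. -/
def posSet (n : ℕ) : Finset ℤ := Finset.Icc 1 (n : ℤ)

/-- `±[n] = {−n, …, −1} ∪ {1, …, n}`, as a finset of integers. -/
def pmSet (n : ℕ) : Finset ℤ := Finset.Icc (-(n : ℤ)) (n : ℤ) \ {0}

/-- The cyclic permutation `γ_n = (1, 2, …, n)` of `[n]`. -/
def gammaZ (n : ℕ) : Equiv.Perm ℤ := ((List.range n).map fun i => ((i : ℤ) + 1)).formPerm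

/-- The permutation `γ̃_n = (1, 2, …, n)(−n, …, −2, −1)` of `±[n]`. -/
def gammaTildeZ (n : ℕ) : Equiv.Perm ℤ :=
  gammaZ n * ((List.range n).map fun i => ((i : ℤ) - (n : ℤ))).formPerm

/-- The involution `τ₀ : a ↦ −a` on `±[n]`, fixing everything outside. -/
def tau0 (n : ℕ) : Equiv.Perm ℤ :=
  ((List.range n).map fun i => Equiv.swap ((i : ℤ) + 1) (-((i : ℤ) + 1))).prod

/-- The involution `τ₂` on `±[n]`, pairing `−k` with `k+1` for `1 ≤ k ≤ n−1`, and `−n`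
with `1`. -/
def tau2 (n : ℕ) : Equiv.Perm ℤ :=
  ((List.range (n - 1)).map fun i => Equiv.swap (-((i : ℤ) + 1)) ((i : ℤ) + 2)).prod *
    Equiv.swap (-(n : ℤ)) 1

/-- The `δ`-condition for a permutation of `S = ±[n]`: no cycle of the form `(r, −r)`,
and together with every cycle `(r₁, …, r_s)`, the cycle `(−r_s, …, −r₁)` also occurs
(the latter is equivalent to `π(−a) = −π⁻¹(a)` for all `a`). -/
def IsDeltaOn (π : Equiv.Perm ℤ) (S : Finset ℤ) : Prop :=
  (∀ r ∈ S, ¬(π r = -r ∧ π (-r) = r)) ∧ ∀ a : ℤ, π (-a) = -(π⁻¹ a)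

/-- `a_g(n) = {π ∈ P₂(n) : #(π⁻¹γ_n) = n/2 + 1 − 2g}`. -/
def aSet (g n : ℕ) : Set (Equiv.Perm ℤ) :=
  {π | IsPairingOn π (posSet n) ∧ cyclesOn (π⁻¹ * gammaZ n) (posSet n) + 2 * g = n / 2 + 1}

/-- `b_k(n)`. -/
def bSet (k n : ℕ) : Set (Equiv.Perm ℤ) :=
  {τ₁ | IsPairingOn τ₁ (pmSet n) ∧ cyclesOn (tau2 n * τ₁) (pmSet n) + 2 * k = n + 2 ∧
    tau0 n * τ₁ = τ₁ * tau0 n ∧ (∀ a ∈ pmSet n, (tau0 n * τ₁) a ≠ a) ∧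
    ∃ a ∈ posSet n, τ₁ a ∈ posSet n}

/-- `NC₂^δ(n, −n)`, the symmetric non-crossing annular pairings of `±[n]`. -/
def ncDelta2 (n : ℕ) : Set (Equiv.Perm ℤ) :=
  {π | IsPairingOn π (pmSet n) ∧ IsNoncrossingOn π (gammaTildeZ n) (pmSet n) ∧
    IsDeltaOn π (pmSet n)}

/-- `γ_{n,u,v} = γ_n · (u−1, v)`, with `(0, v)` read as `(n, v)` when `u = 1`. -/
def gammaUV (n : ℕ) (u v : ℤ) : Equiv.Perm ℤ :=
  gammaZ n * Equiv.swap (if u = 1 then (n : ℤ) else u - 1) v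

/-- `NC₂^T_{u,v}(n)`. -/
def ncT2uv (n : ℕ) (u v : ℤ) : Set (Equiv.Perm ℤ) :=
  {π | IsPairingOn π (posSet n) ∧ IsNoncrossingOn π (gammaUV n u v) (posSet n) ∧
    π u = v ∧ ∀ a : ℤ, 1 ≤ a → a < u → π a ∈ posSet n ∧ ¬(u ≤ π a ∧ π a ≤ v)}

/-- `NC₂^T(n)`. -/
def ncT2 (n : ℕ) : Set (Equiv.Perm ℤ) :=
  {π | ∃ u v : ℤ, 1 ≤ u ∧ u < v ∧ v < (n : ℤ) ∧ π ∈ ncT2uv n u v}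

/-- `γ̃_{n,u,v} = γ̃_n · (−u, v−1) · (−v, u−1)`, with `(−v, 0)` read as `(−v, n)` when
`u = 1`. -/
def gammaTildeUV (n : ℕ) (u v : ℤ) : Equiv.Perm ℤ :=
  gammaTildeZ n * Equiv.swap (-u) (v - 1) *
    Equiv.swap (-v) (if u = 1 then (n : ℤ) else u - 1)

/-- `NC₂^K_{u,v}(n)`. -/
def ncK2uv (n : ℕ) (u v : ℤ) : Set (Equiv.Perm ℤ) :=
  {π | IsPairingOn π (pmSet n) ∧ IsNoncrossingOn π (gammaTildeUV n u v) (pmSet n) ∧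
    IsDeltaOn π (pmSet n) ∧ π u = -v ∧ ∀ a : ℤ, 1 ≤ a → a < u → π a ∈ posSet n}

/-- `NC₂^K(n)`. -/
def ncK2 (n : ℕ) : Set (Equiv.Perm ℤ) :=
  {π | ∃ u v : ℤ, 1 ≤ u ∧ u < v ∧ v < (n : ℤ) ∧ π ∈ ncK2uv n u v}

/-- The odd elements `{1, 3, …, 2n−1}` of `[2n]`. -/
def oddPosSet (n : ℕ) : Finset ℤ := (posSet (2 * n)).filter fun a => Odd a

/-- `ã_{g,p}(n)`. -/
def aTildeSet (g p n : ℕ) : Set (Equiv.Perm ℤ) :=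
  {π | π ∈ aSet g (2 * n) ∧ (∀ a ∈ posSet (2 * n), Even a → Odd (π a)) ∧
    cyclesOn (π⁻¹ * gammaZ (2 * n)) (oddPosSet n) = p}

/-- `B(n) = {1, 3, …, 2n−1} ∪ {−2, −4, …, −2n} ⊂ ±[2n]`. -/
def BSet (n : ℕ) : Finset ℤ :=
  (pmSet (2 * n)).filter fun a => (0 < a ∧ Odd a) ∨ (a < 0 ∧ Even a)

/-- `W(n) = {2, 4, …, 2n} ∪ {−1, −3, …, −(2n−1)} ⊂ ±[2n]`. -/
def WSet (n : ℕ) : Finset ℤ :=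
  (pmSet (2 * n)).filter fun a => (0 < a ∧ Even a) ∨ (a < 0 ∧ Odd a)

/-- `b̃_{k,p}(n)`. -/
def bTildeSet (k p n : ℕ) : Set (Equiv.Perm ℤ) :=
  {τ₁ | τ₁ ∈ bSet k (2 * n) ∧ (∀ a ∈ BSet n, τ₁ a ∈ BSet n) ∧
    cyclesOn (tau2 (2 * n) * τ₁) (WSet n) = 2 * p}

/-- `â_{g,p}(n) = {π ∈ S_{[n]} : #(π) = p, #(π⁻¹γ_n) = n − p + 1 − 2g}`. -/
def aHatSet (g p n : ℕ) : Set (Equiv.Perm ℤ) :=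
  {π | IsPermOn π (posSet n) ∧ cyclesOn π (posSet n) = p ∧
    cyclesOn (π⁻¹ * gammaZ n) (posSet n) + p + 2 * g = n + 1}

/-- `b̂_{k,p}(n)`. -/
def bHatSet (k p n : ℕ) : Set (Equiv.Perm ℤ) :=
  {τ₁ | IsPermOn τ₁ (pmSet n) ∧ cyclesOn τ₁ (pmSet n) = 2 * p ∧
    cyclesOn (gammaTildeZ n * τ₁) (pmSet n) + 2 * p + 2 * k = 2 * n + 2 ∧
    tau0 n * τ₁ * tau0 n = τ₁⁻¹ ∧ (∀ a ∈ pmSet n, (tau0 n * τ₁) a ≠ a) ∧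
    ∃ a ∈ posSet n, -(τ₁ a) ∈ posSet n}

/-- `ÑC₂^{δ,p}(2n, −2n)`. -/
def ncDelta2Tilde (p n : ℕ) : Set (Equiv.Perm ℤ) :=
  {π | π ∈ ncDelta2 (2 * n) ∧ (∀ a ∈ WSet n, π a ∈ BSet n) ∧
    cyclesOn (π⁻¹ * gammaTildeZ (2 * n)) (BSet n) = 2 * p}

/-- `ÑC₂^{T,p}(2n)`. -/
def ncT2Tilde (p n : ℕ) : Set (Equiv.Perm ℤ) :=
  {π | ∃ u v : ℤ, 1 ≤ u ∧ u < v ∧ v < (2 * n : ℤ) ∧ Odd (v - u) ∧ π ∈ ncT2uv (2 * n) u v ∧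
    (∀ a ∈ posSet (2 * n), Even a → Odd (π a)) ∧
    cyclesOn (π⁻¹ * gammaZ (2 * n)) (oddPosSet n) = p}

/-- `ÑC₂^{K,p}(2n)`. -/
def ncK2Tilde (p n : ℕ) : Set (Equiv.Perm ℤ) :=
  {π | ∃ u v : ℤ, 1 ≤ u ∧ u < v ∧ v < (2 * n : ℤ) ∧ Even (v - u) ∧ π ∈ ncK2uv (2 * n) u v ∧
    (∀ a ∈ WSet n, π a ∈ BSet n) ∧
    cyclesOn (π⁻¹ * gammaTildeZ (2 * n)) (BSet n) = 2 * p}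

/-- `NC^{T,p}(n)` (non-crossing annular permutations, toroidal case). -/
def ncTPerm (p n : ℕ) : Set (Equiv.Perm ℤ) :=
  {π | ∃ u v : ℤ, 1 ≤ u ∧ u < v ∧ v < (n : ℤ) ∧ IsPermOn π (posSet n) ∧
    IsNoncrossingOn π (gammaUV n u v) (posSet n) ∧ π⁻¹ u = v ∧
    cyclesOn π (posSet n) = p ∧
    ∀ a : ℤ, 1 ≤ a → a < u → π⁻¹ a ∈ posSet n ∧ ¬(u ≤ π⁻¹ a ∧ π⁻¹ a ≤ v)}

/-- `NC^{δ,p}(n, −n)` (symmetric non-crossing annular permutations). -/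
def ncDeltaPerm (p n : ℕ) : Set (Equiv.Perm ℤ) :=
  {π | IsPermOn π (pmSet n) ∧ IsNoncrossingOn π (gammaTildeZ n) (pmSet n) ∧
    IsDeltaOn π (pmSet n) ∧ cyclesOn π (pmSet n) = 2 * p}

/-- `NC^{K,p}(n)` (non-crossing annular permutations, Klein bottle case). -/
def ncKPerm (p n : ℕ) : Set (Equiv.Perm ℤ) :=
  {π | ∃ u v : ℤ, 1 ≤ u ∧ u < v ∧ v < (n : ℤ) ∧ IsPermOn π (pmSet n) ∧
    IsNoncrossingOn π (gammaTildeUV n u v) (pmSet n) ∧ IsDeltaOn π (pmSet n) ∧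
    π u = -v ∧ cyclesOn π (pmSet n) = 2 * p ∧
    ∀ a : ℤ, 1 ≤ a → a < u → π⁻¹ a ∈ posSet n}


theorem sameCycle_mem {α : Type*} {τ : Equiv.Perm α} {T : Set α} (hT : T.Finite)
    (h : Set.MapsTo τ T T) {a b : α} (ha : a ∈ T) (hab : τ.SameCycle a b) : b ∈ T := by
  have hinv : Set.MapsTo (τ⁻¹ : Equiv.Perm α) T T := by
    intro c hc
    have himg : τ '' T = T := Set.eq_of_subset_of_ncard_le h.image_subset
      (Set.ncard_image_of_injective T τ.injective).ge hT
    rw [← himg] at hc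
    obtain ⟨d, hd, rfl⟩ := hc
    simpa using hd
  obtain ⟨i, rfl⟩ := hab
  induction i using Int.induction_on with
  | zero => simpa using ha
  | succ i ih =>
    rw [add_comm, zpow_add, Equiv.Perm.mul_apply, zpow_one]
    exact h ih
  | pred i ih =>
    rw [sub_eq_add_neg, add_comm, zpow_add, Equiv.Perm.mul_apply, zpow_neg_one]
    exact hinv ih

/-- A relation which is an equivalence and contains `a ~ τ a` contains `SameCycle`. -/
theorem sameCycle_of_step {α : Type*} {τ : Equiv.Perm α} (P : α → Prop)
    (h : ∀ c, P c ↔ P (τ c)) {a b : α} (hab : τ.SameCycle a b) : P a → P b := by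
  intro ha
  obtain ⟨i, rfl⟩ := hab
  induction i using Int.induction_on with
  | zero => simpa using ha
  | succ i ih =>
    rw [add_comm, zpow_add, Equiv.Perm.mul_apply, zpow_one]
    exact (h _).1 ih
  | pred i ih =>
    rw [sub_eq_add_neg, add_comm, zpow_add, Equiv.Perm.mul_apply, zpow_neg_one]
    rw [h]
    simpa using ih

theorem setOf_eq_iff {α : Type*} {σ : Equiv.Perm α} {a b : α} :
    ({c | σ.SameCycle a c} = {c | σ.SameCycle b c}) ↔ σ.SameCycle a b := by
  constructor
  · intro h
    have : b ∈ {c | σ.SameCycle b c} := Equiv.Perm.SameCycle.refl _ _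
    rw [← h] at this
    exact this
  · intro h
    ext c
    exact ⟨fun k => h.symm.trans k, fun k => h.trans k⟩

theorem cyclesOn_mul_swap {α : Type*} [DecidableEq α] (σ : Equiv.Perm α) (S : Finset α)
    {x y : α} (hx : x ∈ S) (hy : y ∈ S)
    (hs : σ.SameCycle x y) (hns : ¬ (σ * Equiv.swap x y).SameCycle x y) :
    cyclesOn (σ * Equiv.swap x y) S = cyclesOn σ S + 1 := by
  set τ := σ * Equiv.swap x y with hτ
  have hsw : ∀ c, τ c = σ (Equiv.swap x y c) := fun c => rfl
  -- swap preserves σ classes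
  have h0 : ∀ c, σ.SameCycle c (Equiv.swap x y c) := by
    intro c
    by_cases h1 : c = x
    · subst h1; simpa using hs
    by_cases h2 : c = y
    · subst h2; simpa using hs.symm
    rw [Equiv.swap_apply_of_ne_of_ne h1 h2]
  have h1 : ∀ a b, τ.SameCycle a b → σ.SameCycle a b := by
    intro a b hab
    refine sameCycle_of_step (fun c => σ.SameCycle a c) ?_ hab (Equiv.Perm.SameCycle.refl _ _)
    intro c
    have : σ.SameCycle c (τ c) := by
      rw [hsw, Equiv.Perm.sameCycle_apply_right]
      exact h0 c
    exact ⟨fun h => h.trans this, fun h => h.trans this.symm⟩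
  have h2 : ∀ a, σ.SameCycle x a → τ.SameCycle x a ∨ τ.SameCycle y a := by
    intro a hab
    have hw : ∀ c, (τ.SameCycle x c ∨ τ.SameCycle y c) ↔
        (τ.SameCycle x (Equiv.swap x y c) ∨ τ.SameCycle y (Equiv.swap x y c)) := by
      intro c
      by_cases h1 : c = x
      · subst h1
        simp [Equiv.Perm.SameCycle.refl]
      by_cases h2 : c = y
      · subst h2
        simp [Equiv.Perm.SameCycle.refl]
      rw [Equiv.swap_apply_of_ne_of_ne h1 h2]
    refine sameCycle_of_step (fun c => τ.SameCycle x c ∨ τ.SameCycle y c) ?_ hab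
      (Or.inl (Equiv.Perm.SameCycle.refl _ _))
    intro c
    have : σ c = τ (Equiv.swap x y c) := by rw [hsw, Equiv.swap_apply_self]
    simp only [this, Equiv.Perm.sameCycle_apply_right]
    exact hw c
  have h3 : ∀ a b, ¬ σ.SameCycle x a → σ.SameCycle a b → τ.SameCycle a b := by
    intro a b hxa hab
    have := sameCycle_of_step (fun c => ¬ σ.SameCycle x c → τ.SameCycle a c) ?_ hab
      (fun _ => Equiv.Perm.SameCycle.refl _ _)
    · exact this (fun h => hxa (h.trans hab.symm))
    intro c
    rw [Equiv.Perm.sameCycle_apply_right]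
    by_cases hc : σ.SameCycle x c
    · simp [hc]
    have e1 : c ≠ x := by rintro rfl; exact hc (Equiv.Perm.SameCycle.refl _ _)
    have e2 : c ≠ y := by rintro rfl; exact hc hs
    have : σ c = τ c := by rw [hsw, Equiv.swap_apply_of_ne_of_ne e1 e2]
    rw [this, Equiv.Perm.sameCycle_apply_right]
  unfold cyclesOn
  set A := (fun a => {b | σ.SameCycle a b}) '' (S : Set α) with hA
  have hAf : A.Finite := S.finite_toSet.image _
  have hxA : {b | σ.SameCycle x b} ∈ A := ⟨x, hx, rfl⟩
  have hB : (fun a => {b | τ.SameCycle a b}) '' (S : Set α) =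
      insert {b | τ.SameCycle x b} (insert {b | τ.SameCycle y b} (A \ {{b | σ.SameCycle x b}})) := by
    ext C
    constructor
    · rintro ⟨a, ha, rfl⟩
      by_cases hxa : σ.SameCycle x a
      · rcases h2 a hxa with h | h
        · left; exact setOf_eq_iff.2 h.symm
        · right; left; exact setOf_eq_iff.2 h.symm
      · right; right
        refine ⟨⟨a, ha, ?_⟩, ?_⟩
        · ext b; exact ⟨fun h => h3 a b hxa h, fun h => h1 a b h⟩
        · intro h
          have : a ∈ ({b | σ.SameCycle x b} : Set α) := by
            rw [← Set.mem_singleton_iff.1 h]; exact Equiv.Perm.SameCycle.refl _ _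
          exact hxa this
    · rintro (rfl | rfl | ⟨⟨a, ha, rfl⟩, hne⟩)
      · exact ⟨x, hx, rfl⟩
      · exact ⟨y, hy, rfl⟩
      · have hxa : ¬ σ.SameCycle x a := by
          intro h; exact hne (setOf_eq_iff.2 h.symm)
        refine ⟨a, ha, ?_⟩
        ext b; exact ⟨fun h => h1 a b h, fun h => h3 a b hxa h⟩
  have hk : ∀ z, σ.SameCycle x z → {b | τ.SameCycle z b} ∉ A \ {{b | σ.SameCycle x b}} := by
    rintro z hz ⟨⟨a, ha, he⟩, hne⟩
    have he' : {b | σ.SameCycle a b} = {b | τ.SameCycle z b} := he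
    have hz' : z ∈ {b | σ.SameCycle a b} := by rw [he']; exact Equiv.Perm.SameCycle.refl _ _
    apply hne
    rw [← he']
    exact setOf_eq_iff.2 (Equiv.Perm.SameCycle.trans hz' hz.symm)
  rw [hB, Set.ncard_insert_of_notMem _ ((hAf.sdiff).insert _),
    Set.ncard_insert_of_notMem (hk y hs) hAf.sdiff, Set.ncard_sdiff_singleton_of_mem hxA]
  · have : 0 < A.ncard := (Set.ncard_pos hAf).2 ⟨_, hxA⟩
    omega
  · rintro (h | h)
    · exact hns (setOf_eq_iff.1 h)
    · exact hk x (Equiv.Perm.SameCycle.refl _ _) h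

theorem gammaZ_eq (m : ℕ) :
    gammaZ m = ((List.range m).map fun i : ℕ => ((i : ℤ) + 1)).formPerm := by
  unfold gammaZ
  congr 1
  simp [List.map_flatMap, ← List.map_eq_flatMap]

theorem gammaZ_lt {m : ℕ} {a : ℤ} (h1 : 1 ≤ a) (h2 : a < m) : gammaZ m a = a + 1 := by
  obtain ⟨i, rfl⟩ : ∃ i : ℕ, a = (i : ℤ) + 1 := ⟨(a - 1).toNat, by omega⟩
  set l := (List.range m).map fun i : ℕ => ((i : ℤ) + 1) with hl
  have hnd : l.Nodup := List.nodup_range.map (fun i j h => by simpa using h)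
  have hlen : l.length = m := by simp [hl]
  have := List.formPerm_apply_getElem l hnd i (by omega)
  have hmod : (i + 1) % m = i + 1 := Nat.mod_eq_of_lt (by omega)
  simpa [hl, hmod, gammaZ_eq] using this

theorem gammaZ_last {m : ℕ} (h : 1 ≤ m) : gammaZ m m = 1 := by
  set l := (List.range m).map fun i : ℕ => ((i : ℤ) + 1) with hl
  have hnd : l.Nodup := List.nodup_range.map (fun i j h => by simpa using h)
  have hlen : l.length = m := by simp [hl]
  have := List.formPerm_apply_getElem l hnd (m - 1) (by omega)
  have hmod : (m - 1 + 1) % m = 0 := by rw [Nat.sub_add_cancel h, Nat.mod_self]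
  have hc : ((m - 1 : ℕ) : ℤ) + 1 = m := by omega
  simpa [hl, hmod, gammaZ_eq, hc, -Nat.cast_sub, -Nat.cast_pred] using this

theorem gammaZ_out {m : ℕ} {a : ℤ} (h : a ∉ posSet m) : gammaZ m a = a := by
  rw [gammaZ_eq]
  apply List.formPerm_apply_of_notMem
  intro hm
  simp only [List.mem_map, List.mem_range] at hm
  obtain ⟨i, hi, rfl⟩ := hm
  apply h
  simp only [posSet, Finset.mem_Icc]
  omega

theorem mem_posSet {m : ℕ} {a : ℤ} : a ∈ posSet m ↔ 1 ≤ a ∧ a ≤ m := by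
  simp [posSet]

theorem gammaZ_sameCycle {m : ℕ} {a : ℤ} (h1 : 1 ≤ a) (h2 : a ≤ m) :
    (gammaZ m).SameCycle 1 a := by
  induction a, h1 using Int.le_induction with
  | base => exact Equiv.Perm.SameCycle.refl _ _
  | succ a ha ih =>
    have := ih (by omega)
    rw [← gammaZ_lt ha (by omega : a < m), Equiv.Perm.sameCycle_apply_right]
    exact this

theorem cyclesOn_gammaZ {m : ℕ} (h : 1 ≤ m) : cyclesOn (gammaZ m) (posSet m) = 1 := by
  unfold cyclesOn
  rw [Set.ncard_eq_one]
  refine ⟨{b | (gammaZ m).SameCycle 1 b}, ?_⟩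
  ext C
  constructor
  · rintro ⟨a, ha, rfl⟩
    have ha := mem_posSet.1 (Finset.mem_coe.1 ha)
    exact setOf_eq_iff.2 (gammaZ_sameCycle ha.1 ha.2).symm
  · rintro rfl
    exact ⟨1, Finset.mem_coe.2 (mem_posSet.2 ⟨le_refl _, by omega⟩), rfl⟩

/-- even elements -/
def evenPos (n : ℕ) : Finset ℤ := (posSet (2 * n)).filter fun a => Even a

theorem card_evenPos (n : ℕ) : (evenPos n).card = n := by
  have : evenPos n = (Finset.range n).image (fun i : ℕ => 2 * (i : ℤ) + 2) := by
    ext a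
    simp only [evenPos, Finset.mem_filter, mem_posSet, Finset.mem_image, Finset.mem_range]
    constructor
    · rintro ⟨⟨h1, h2⟩, k, hk⟩
      exact ⟨(k - 1).toNat, by push_cast at h2; omega, by omega⟩
    · rintro ⟨i, hi, rfl⟩
      exact ⟨⟨by omega, by push_cast; omega⟩, (i : ℤ) + 1, by ring⟩
  rw [this, Finset.card_image_of_injective _ (fun i j h => by simpa using h), Finset.card_range]

theorem card_oddPos (n : ℕ) : (oddPosSet n).card = n := by
  have : oddPosSet n = (Finset.range n).image (fun i : ℕ => 2 * (i : ℤ) + 1) := by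
    ext a
    simp only [oddPosSet, Finset.mem_filter, mem_posSet, Finset.mem_image, Finset.mem_range]
    constructor
    · rintro ⟨⟨h1, h2⟩, k, hk⟩
      exact ⟨k.toNat, by push_cast at h2; omega, by omega⟩
    · rintro ⟨i, hi, rfl⟩
      exact ⟨⟨by omega, by push_cast; omega⟩, (i : ℤ), by ring⟩
  rw [this, Finset.card_image_of_injective _ (fun i j h => by simpa using h), Finset.card_range]

section pairing

variable {n : ℕ} {π : Equiv.Perm ℤ}

theorem pair_invol {S : Finset ℤ} (h : IsPairingOn π S) (a : ℤ) : π (π a) = a := by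
  have := congrArg (fun f : Equiv.Perm ℤ => f a) h.1
  simpa using this

theorem pair_inv {S : Finset ℤ} (h : IsPairingOn π S) : π⁻¹ = π :=
  inv_eq_of_mul_eq_one_right h.1

theorem pair_mem {S : Finset ℤ} (h : IsPairingOn π S) {a : ℤ} (ha : a ∈ S) : π a ∈ S := by
  by_contra hc
  have h1 := h.2.2 _ hc
  rw [pair_invol h] at h1
  exact h.2.1 a ha h1.symm

theorem pair_odd (h : IsPairingOn π (posSet (2 * n)))
    (he : ∀ a ∈ posSet (2 * n), Even a → Odd (π a)) {a : ℤ} (ha : a ∈ posSet (2 * n))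
    (hodd : Odd a) : Even (π a) := by
  have himg : (evenPos n).image π = oddPosSet n := by
    apply Finset.eq_of_subset_of_card_le
    · intro b hb
      obtain ⟨c, hc, rfl⟩ := Finset.mem_image.1 hb
      have hc := Finset.mem_filter.1 hc
      exact Finset.mem_filter.2 ⟨pair_mem h hc.1, he c hc.1 hc.2⟩
    · rw [Finset.card_image_of_injective _ π.injective, card_oddPos, card_evenPos]
  have : a ∈ (evenPos n).image π := by
    rw [himg]; exact Finset.mem_filter.2 ⟨ha, hodd⟩
  obtain ⟨c, hc, rfl⟩ := Finset.mem_image.1 this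
  rw [pair_invol h]
  exact (Finset.mem_filter.1 hc).2

theorem cyclesOn_pairing (h : IsPairingOn π (posSet (2 * n)))
    (he : ∀ a ∈ posSet (2 * n), Even a → Odd (π a)) : cyclesOn π (posSet (2 * n)) = n := by
  unfold cyclesOn
  have : (fun a => {b | π.SameCycle a b}) '' ((posSet (2 * n) : Finset ℤ) : Set ℤ) =
      (fun a => {b | π.SameCycle a b}) '' ((evenPos n : Finset ℤ) : Set ℤ) := by
    apply Set.Subset.antisymm
    · rintro C ⟨a, ha, rfl⟩
      have ha := Finset.mem_coe.1 ha
      rcases Int.even_or_odd a with h1 | h1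
      · exact ⟨a, Finset.mem_coe.2 (Finset.mem_filter.2 ⟨ha, h1⟩), rfl⟩
      · refine ⟨π a, Finset.mem_coe.2 (Finset.mem_filter.2 ⟨pair_mem h ha, pair_odd h he ha h1⟩), ?_⟩
        apply setOf_eq_iff.2
        rw [Equiv.Perm.sameCycle_apply_left]
    · apply Set.image_mono
      intro a ha
      exact Finset.mem_coe.2 (Finset.mem_filter.1 (Finset.mem_coe.1 ha)).1
  rw [this, Set.InjOn.ncard_image, Set.ncard_coe_finset, card_evenPos]
  intro a ha b hb hab
  have ha := Finset.mem_filter.1 (Finset.mem_coe.1 ha)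
  have hb := Finset.mem_filter.1 (Finset.mem_coe.1 hb)
  have hs : π.SameCycle a b := setOf_eq_iff.1 hab
  have := sameCycle_mem (τ := π) (T := {a, π a}) (Set.toFinite _) (by
    rintro c (rfl | rfl)
    · right; rfl
    · left; exact pair_invol h a) (Or.inl rfl) hs
  rcases this with h1 | h1
  · exact h1.symm
  · have h2 := he a ha.1 ha.2
    rw [← Set.mem_singleton_iff.1 h1] at h2
    exact absurd hb.2 (Int.not_even_iff_odd.2 h2)

/-- A pairing without crossings has at least `n` cycles in its complement. -/
theorem exists_crossing (h : IsPairingOn π (posSet (2 * n)))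
    (he : ∀ a ∈ posSet (2 * n), Even a → Odd (π a))
    (hc : cyclesOn (π * gammaZ (2 * n)) (posSet (2 * n)) < n) :
    ∃ u x : ℤ, u ∈ posSet (2 * n) ∧ u < x ∧ x < π u ∧ ¬ (u ≤ π x ∧ π x ≤ π u) := by
  by_contra hno
  push Not at hno
  apply absurd hc
  rw [not_lt]
  have hinv : ∀ u ∈ posSet (2 * n), u < π u → ∀ b,
      (π * gammaZ (2 * n)).SameCycle u b → u ≤ b := by
    intro u hu huv b hb
    have hv := mem_posSet.1 (pair_mem h hu)
    have hu' := mem_posSet.1 hu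
    have := sameCycle_mem (τ := π * gammaZ (2 * n)) (T := Set.Ico u (π u)) (Set.finite_Ico _ _) (by
      rintro a ⟨h1, h2⟩
      rw [Equiv.Perm.mul_apply, gammaZ_lt (by omega) (by omega)]
      by_cases h3 : a + 1 = π u
      · rw [h3, pair_invol h]; exact ⟨le_refl _, huv⟩
      · have h4 := hno u (a + 1) hu (by omega) (by omega)
        refine ⟨h4.1, lt_of_le_of_ne h4.2 ?_⟩
        intro h5
        have := π.injective h5
        omega) ⟨le_refl _, huv⟩ hb
    exact this.1
  have hmin : ∀ a ∈ posSet (2 * n), min a (π a) ∈ posSet (2 * n) ∧ min a (π a) < π (min a (π a)) := by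
    intro a ha
    have h1 := h.2.1 a ha
    rcases lt_or_gt_of_ne h1 with h2 | h2
    · rw [min_eq_right h2.le, pair_invol h]; exact ⟨pair_mem h ha, h2⟩
    · rw [min_eq_left h2.le]; exact ⟨ha, h2⟩
  unfold cyclesOn
  have hinj : Set.InjOn (fun a => {b | (π * gammaZ (2 * n)).SameCycle (min a (π a)) b})
      ((evenPos n : Finset ℤ) : Set ℤ) := by
    intro a ha b hb hab
    have ha := Finset.mem_filter.1 (Finset.mem_coe.1 ha)
    have hb := Finset.mem_filter.1 (Finset.mem_coe.1 hb)
    have hs := setOf_eq_iff.1 hab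
    have h1 := hinv _ (hmin a ha.1).1 (hmin a ha.1).2 _ hs
    have h2 := hinv _ (hmin b hb.1).1 (hmin b hb.1).2 _ hs.symm
    have h3 : min a (π a) = min b (π b) := le_antisymm h1 h2
    have oa := he a ha.1 ha.2
    have ob := he b hb.1 hb.2
    have ea := ha.2
    have eb := hb.2
    rcases min_choice a (π a) with h4 | h4 <;> rcases min_choice b (π b) with h5 | h5 <;>
      rw [h4, h5] at h3
    · exact h3
    · rw [h3] at ea; exact absurd ea (Int.not_even_iff_odd.2 ob)
    · rw [← h3] at eb; exact absurd eb (Int.not_even_iff_odd.2 oa)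
    · exact π.injective h3
  calc n = (evenPos n).card := (card_evenPos n).symm
    _ = ((fun a => {b | (π * gammaZ (2 * n)).SameCycle (min a (π a)) b}) ''
          ((evenPos n : Finset ℤ) : Set ℤ)).ncard := by
        rw [Set.InjOn.ncard_image hinj, Set.ncard_coe_finset]
    _ ≤ _ := by
        apply Set.ncard_le_ncard _ ((Finset.finite_toSet _).image _)
        rintro C ⟨a, ha, rfl⟩
        have ha := Finset.mem_filter.1 (Finset.mem_coe.1 ha)
        exact ⟨_, Finset.mem_coe.2 (hmin a ha.1).1, rfl⟩

/-- the predecessor of `u` -/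
def predU (n : ℕ) (u : ℤ) : ℤ := if u = 1 then ((2 * n : ℕ) : ℤ) else u - 1

theorem gammaUV_eq (n : ℕ) (u v : ℤ) :
    gammaUV (2 * n) u v = gammaZ (2 * n) * Equiv.swap (predU n u) v := rfl

variable {u v : ℤ}

theorem predU_spec (h1 : 1 ≤ u) (h2 : u < v) (h3 : v < (2 * n : ℤ)) :
    predU n u ∈ posSet (2 * n) ∧ predU n u ≠ v ∧ gammaZ (2 * n) (predU n u) = u ∧
      (predU n u < u ∨ v < predU n u) := by
  unfold predU
  split_ifs with h
  · subst h
    refine ⟨mem_posSet.2 ⟨by push_cast; omega, le_refl _⟩, by push_cast; omega,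
      gammaZ_last (by omega), Or.inr (by push_cast; omega)⟩
  · refine ⟨mem_posSet.2 ⟨by omega, by push_cast; omega⟩, by omega, ?_, Or.inl (by omega)⟩
    rw [gammaZ_lt (by omega) (by push_cast; omega)]
    ring

theorem gammaUV_v (h1 : 1 ≤ u) (h2 : u < v) (h3 : v < (2 * n : ℤ)) :
    gammaUV (2 * n) u v v = u := by
  rw [gammaUV_eq, Equiv.Perm.mul_apply, Equiv.swap_apply_right]
  exact (predU_spec h1 h2 h3).2.2.1

theorem gammaUV_pred (h1 : 1 ≤ u) (h2 : u < v) (h3 : v < (2 * n : ℤ)) :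
    gammaUV (2 * n) u v (predU n u) = v + 1 := by
  rw [gammaUV_eq, Equiv.Perm.mul_apply, Equiv.swap_apply_left]
  exact gammaZ_lt (by omega) (by push_cast; omega)

theorem gammaUV_lt {a : ℤ} (ha : 1 ≤ a) (ha2 : a < (2 * n : ℤ)) (hav : a ≠ v)
    (hap : a ≠ predU n u) :
    gammaUV (2 * n) u v a = a + 1 := by
  rw [gammaUV_eq, Equiv.Perm.mul_apply, Equiv.swap_apply_of_ne_of_ne hap hav]
  exact gammaZ_lt ha (by push_cast; omega)

theorem cyclesOn_gammaUV (h1 : 1 ≤ u) (h2 : u < v) (h3 : v < (2 * n : ℤ)) :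
    cyclesOn (gammaUV (2 * n) u v) (posSet (2 * n)) = 2 := by
  have hp := predU_spec h1 h2 h3
  have hp1 := mem_posSet.1 hp.1
  rw [gammaUV_eq, cyclesOn_mul_swap _ _ hp.1 (mem_posSet.2 ⟨by omega, by push_cast; omega⟩),
    cyclesOn_gammaZ (by omega)]
  · exact (gammaZ_sameCycle hp1.1 hp1.2).symm.trans
      (gammaZ_sameCycle (by omega) (by push_cast; omega))
  · intro hs
    rw [← gammaUV_eq] at hs
    have := sameCycle_mem (T := Set.Icc u v) (Set.finite_Icc _ _) (by
      rintro a ⟨ha1, ha2⟩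
      by_cases hav : a = v
      · rw [hav, gammaUV_v h1 h2 h3]; exact ⟨le_refl _, h2.le⟩
      · rw [gammaUV_lt (by omega) (by omega) hav (by omega)]
        exact ⟨by omega, by omega⟩) ⟨h2.le, le_refl v⟩ hs.symm
    have h5 := this.1
    have h6 := this.2
    omega

theorem cyclesOn_compl (h : IsPairingOn π (posSet (2 * n)))
    (h1 : 1 ≤ u) (h2 : u < v) (h3 : v < (2 * n : ℤ)) (huv : π u = v) :
    cyclesOn (π⁻¹ * gammaUV (2 * n) u v) (posSet (2 * n)) =
      cyclesOn (π⁻¹ * gammaZ (2 * n)) (posSet (2 * n)) + 1 := by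
  have hp := predU_spec h1 h2 h3
  have hval : (π * gammaZ (2 * n)) (predU n u) = v := by
    rw [Equiv.Perm.mul_apply, hp.2.2.1, huv]
  rw [pair_inv h, gammaUV_eq, ← mul_assoc]
  apply cyclesOn_mul_swap _ _ hp.1 (mem_posSet.2 ⟨by omega, by push_cast; omega⟩)
  · rw [← hval, Equiv.Perm.sameCycle_apply_right]
  · intro hs
    have := sameCycle_mem (T := {v}) (Set.finite_singleton _) (by
      rintro a ha
      rw [Set.mem_singleton_iff.1 ha, Equiv.Perm.mul_apply, Equiv.swap_apply_right, hval]
      rfl) rfl hs.symm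
    exact hp.2.1 this

theorem transitive_of_crossing (h : IsPairingOn π (posSet (2 * n)))
    (h1 : 1 ≤ u) (h2 : u < v) (h3 : v < (2 * n : ℤ))
    {x : ℤ} (hx1 : u ≤ x) (hx2 : x ≤ v) (hx3 : ¬ (u ≤ π x ∧ π x ≤ v)) :
    ∀ a ∈ posSet (2 * n), ∀ b ∈ posSet (2 * n),
      ∃ σ ∈ Subgroup.closure ({π, gammaUV (2 * n) u v} : Set (Equiv.Perm ℤ)), σ a = b := by
  set G := Subgroup.closure ({π, gammaUV (2 * n) u v} : Set (Equiv.Perm ℤ)) with hG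
  set g := gammaUV (2 * n) u v with hg
  have hgG : g ∈ G := Subgroup.subset_closure (Or.inr rfl)
  have hπG : π ∈ G := Subgroup.subset_closure (Or.inl rfl)
  let R : ℤ → ℤ → Prop := fun a b => ∃ σ ∈ G, σ a = b
  have rrefl : ∀ a, R a a := fun a => ⟨1, G.one_mem, rfl⟩
  have rsymm : ∀ {a b}, R a b → R b a := by
    rintro a b ⟨σ, hσ, rfl⟩
    exact ⟨σ⁻¹, G.inv_mem hσ, by simp⟩
  have rtrans : ∀ {a b c}, R a b → R b c → R a c := by
    rintro a b c ⟨σ, hσ, rfl⟩ ⟨τ, hτ, rfl⟩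
    exact ⟨τ * σ, G.mul_mem hτ hσ, rfl⟩
  have rg : ∀ a, R a (g a) := fun a => ⟨g, hgG, rfl⟩
  have rπ : ∀ a, R a (π a) := fun a => ⟨π, hπG, rfl⟩
  have hp := predU_spec h1 h2 h3
  have inner : ∀ a, u ≤ a → a ≤ v → R u a := by
    intro a ha
    induction a, ha using Int.le_induction with
    | base => intro _; exact rrefl _
    | succ a ha ih =>
      intro hav
      have h4 := rg a
      rw [hg, gammaUV_lt (by omega) (by omega) (by omega) (by omega)] at h4
      exact rtrans (ih (by omega)) h4
  have outer1 : ∀ a, v + 1 ≤ a → a ≤ (2 * n : ℤ) → R (v + 1) a := by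
    intro a ha
    induction a, ha using Int.le_induction with
    | base => intro _; exact rrefl _
    | succ a ha ih =>
      intro hav
      have h4 := rg a
      have : a ≠ predU n u := by
        unfold predU; split_ifs
        · push_cast; omega
        · omega
      rw [hg, gammaUV_lt (by omega) (by omega) (by omega) this] at h4
      exact rtrans (ih (by omega)) h4
  have outer2 : ∀ a, 1 ≤ a → a < u → R (v + 1) a := by
    intro a ha
    induction a, ha using Int.le_induction with
    | base =>
      intro hu
      have h4 := rg ((2 * n : ℕ) : ℤ)
      have h5 : ((2 * n : ℕ) : ℤ) ≠ predU n u := by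
        unfold predU; rw [if_neg (by omega)]; push_cast; omega
      rw [hg, gammaUV_eq, Equiv.Perm.mul_apply,
        Equiv.swap_apply_of_ne_of_ne h5 (by push_cast; omega), gammaZ_last (by omega)] at h4
      exact rtrans (outer1 _ (by push_cast; omega) (by push_cast; omega)) h4
    | succ a ha ih =>
      intro hav
      have h4 := rg a
      have : a ≠ predU n u := by
        unfold predU; rw [if_neg (by omega)]; omega
      rw [hg, gammaUV_lt (by omega) (by omega) (by omega) this] at h4
      exact rtrans (ih (by omega)) h4
  have outer : ∀ a ∈ posSet (2 * n), ¬ (u ≤ a ∧ a ≤ v) → R (v + 1) a := by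
    intro a ha hna
    have ha := mem_posSet.1 ha
    push_cast at ha
    by_cases hau : a < u
    · exact outer2 a ha.1 hau
    · exact outer1 a (by omega) ha.2
  have hxm : x ∈ posSet (2 * n) := mem_posSet.2 ⟨by omega, by push_cast; omega⟩
  have link : R u (v + 1) :=
    rtrans (inner x hx1 hx2) (rtrans (rπ x) (rsymm (outer _ (pair_mem h hxm) hx3)))
  have all : ∀ a ∈ posSet (2 * n), R u a := by
    intro a ha
    by_cases hin : u ≤ a ∧ a ≤ v
    · exact inner a hin.1 hin.2
    · exact rtrans link (outer a ha hin)
  intro a ha b hb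
  exact rtrans (rsymm (all a ha)) (all b hb)

end pairing

/-- For `n ≥ 1` and `p ≥ 1`, `ã_{1,p}(n) = ÑC₂^{T,p}(2n)` as subsets of
`P₂(2n)`. -/
theorem aTilde1_eq_ncT2Tilde (n p : ℕ) (hn : 1 ≤ n) (hp : 1 ≤ p) :
    aTildeSet 1 p n = ncT2Tilde p n := by
  ext π
  constructor
  · rintro ⟨⟨h, hc⟩, he, hpc⟩
    have hcr := exists_crossing h he (by rw [← pair_inv h, pair_inv h, ← pair_inv h]; omega)
    -- choose the least opener of a crossing pair
    let Q : ℕ → Prop := fun k => ∃ x : ℤ, (k : ℤ) ∈ posSet (2 * n) ∧ (k : ℤ) < x ∧ x < π k ∧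
      ¬ ((k : ℤ) ≤ π x ∧ π x ≤ π k)
    have hQ : ∃ k, Q k := by
      obtain ⟨u, x, hu, hx⟩ := hcr
      have hu' := mem_posSet.1 hu
      refine ⟨u.toNat, x, ?_⟩
      rw [Int.toNat_of_nonneg (by omega)]
      exact ⟨hu, hx⟩
    classical
    obtain ⟨x, hu, hx1, hx2, hx3⟩ := Nat.find_spec hQ
    have hleast : ∀ k, k < Nat.find hQ → ¬ Q k := fun k hk => Nat.find_min hQ hk
    generalize Nat.find hQ = k at *
    have hu' := mem_posSet.1 hu
    push_cast at hu'
    have hv' := mem_posSet.1 (pair_mem h hu)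
    push_cast at hv'
    have hmin : ∀ a : ℤ, 1 ≤ a → a < k → π a ∈ posSet (2 * n) ∧
        ¬ ((k : ℤ) ≤ π a ∧ π a ≤ π k) := by
      intro a ha hak
      have ham : a ∈ posSet (2 * n) := mem_posSet.2 ⟨ha, by push_cast; omega⟩
      refine ⟨pair_mem h ham, ?_⟩
      rintro ⟨h1, h2⟩
      have n1 : π a ≠ k := by
        intro h3; have := congrArg π h3; rw [pair_invol h] at this; omega
      have n2 : π a ≠ π k := by
        intro h3; have := π.injective h3; omega
      apply hleast a.toNat (by omega)
      refine ⟨(k : ℤ), ?_⟩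
      rw [Int.toNat_of_nonneg (by omega)]
      exact ⟨ham, hak, by omega, by omega⟩
    have hvN : π k < (2 * n : ℤ) := by
      rcases lt_or_eq_of_le hv'.2 with h1 | h1
      · exact h1
      · exfalso
        have hxm : x ∈ posSet (2 * n) := mem_posSet.2 ⟨by omega, by push_cast; omega⟩
        have hπx := mem_posSet.1 (pair_mem h hxm)
        push_cast at hπx
        have := (hmin (π x) hπx.1 (by omega)).2
        rw [pair_invol h] at this
        exact this ⟨hx1.le, hx2.le⟩
    refine ⟨k, π k, hu'.1, by omega, hvN, ?_, ⟨h, ⟨?_, ?_⟩, rfl, hmin⟩, he, hpc⟩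
    · rcases Int.even_or_odd (k : ℤ) with h1 | h1
      · exact (he _ hu h1).sub_even h1
      · exact (pair_odd h he hu h1).sub_odd h1
    · exact transitive_of_crossing h hu'.1 (by omega) hvN hx1.le hx2.le hx3
    · rw [cyclesOn_pairing h he, cyclesOn_gammaUV hu'.1 (by omega) hvN,
        cyclesOn_compl h hu'.1 (by omega) hvN rfl]
      have : (posSet (2 * n)).card = 2 * n := by simp [posSet]; omega
      omega
  · rintro ⟨u, v, h1, h2, h3, hodd, ⟨h, ⟨-, hnc⟩, huv, -⟩, he, hpc⟩
    refine ⟨⟨h, ?_⟩, he, hpc⟩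
    rw [cyclesOn_pairing h he, cyclesOn_gammaUV h1 h2 h3, cyclesOn_compl h h1 h2 h3 huv] at hnc
    have : (posSet (2 * n)).card = 2 * n := by simp [posSet]; omega
    omega

end RibbonNC
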